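/- arXiv:2507.20016 — 3 statements merged into one kernel-verified Lean document; each statement's English description precedes it below -/
import Mathlib

section
/- Let E be a real inner product space and let f : E → ℝ be differentiable, β-smooth, and μ-strongly convex with 0 < μ ≤ β. Then for all v, w ∈ E, ⟨∇f(v) − ∇f(w), v − w⟩ ≥ (βμ/(β+μ))‖v − w‖² + (1/(β+μ))‖∇f(v) − ∇f(w)‖². -/
open scoped RealInnerProductSpace

/-- Descent lemma: a function with `β`-Lipschitz gradient lies below its quadratic upper model. -/
theorem le_quadratic_of_lipschitz_gradient
    {E : Type*} [NormedAddCommGroup E] [InnerProductSpace ℝ E] [CompleteSpace E]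
    {f : E → ℝ} {β : ℝ} (hdiff : Differentiable ℝ f)
    (hsmooth : ∀ v w : E, ‖gradient f v - gradient f w‖ ≤ β * ‖v - w‖) (x e : E) :
    f (x + e) ≤ f x + ⟪gradient f x, e⟫ + β / 2 * ‖e‖ ^ 2 := by
  let ψ : ℝ → ℝ := fun t ↦ t * ⟪gradient f x, e⟫ + β / 2 * ‖e‖ ^ 2 * t ^ 2 - f (x + t • e)
  have hψ (t : ℝ) : HasDerivAt ψ
      (⟪gradient f x, e⟫ + β * ‖e‖ ^ 2 * t - ⟪gradient f (x + t • e), e⟫) t := by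
    have hline : HasDerivAt (fun t : ℝ ↦ x + t • e) e t := by
      simpa using ((hasDerivAt_id t).smul_const e).const_add x
    have hf : HasDerivAt (fun t : ℝ ↦ f (x + t • e)) ⟪gradient f (x + t • e), e⟫ t := by
      simpa [Function.comp_def] using
        (hdiff (x + t • e)).hasGradientAt.hasFDerivAt.comp_hasDerivAt t hline
    have hquad : HasDerivAt (fun t : ℝ ↦ β / 2 * ‖e‖ ^ 2 * t ^ 2) (β * ‖e‖ ^ 2 * t) t := by
      refine ((hasDerivAt_pow 2 t).const_mul (β / 2 * ‖e‖ ^ 2)).congr_deriv ?_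
      norm_num
      ring
    exact ((hasDerivAt_mul_const _).add hquad).sub hf
  have hmono : MonotoneOn ψ (Set.Ici 0) := by
    refine monotoneOn_of_deriv_nonneg (convex_Ici 0)
      (fun t _ ↦ (hψ t).continuousAt.continuousWithinAt)
      (fun t _ ↦ (hψ t).differentiableAt.differentiableWithinAt) fun t ht ↦ ?_
    rw [interior_Ici, Set.mem_Ioi] at ht
    rw [(hψ t).deriv]
    have hle : ⟪gradient f (x + t • e) - gradient f x, e⟫ ≤ β * ‖e‖ ^ 2 * t :=
      calc ⟪gradient f (x + t • e) - gradient f x, e⟫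
          ≤ ‖gradient f (x + t • e) - gradient f x‖ * ‖e‖ := real_inner_le_norm _ _
        _ ≤ β * ‖x + t • e - x‖ * ‖e‖ := by gcongr; exact hsmooth _ _
        _ = β * ‖e‖ ^ 2 * t := by
          rw [add_sub_cancel_left, norm_smul, Real.norm_of_nonneg ht.le]
          ring
    rw [inner_sub_left] at hle
    linarith
  have h01 := hmono (Set.mem_Ici.2 le_rfl) (Set.mem_Ici.2 zero_le_one) zero_le_one
  simp only [ψ, zero_smul, one_smul, add_zero] at h01
  linarith

/-- Coercivity of the gradient of a `β`-smooth, `μ`-strongly convex function. -/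
theorem grad_coercivity
    {E : Type*} [NormedAddCommGroup E] [InnerProductSpace ℝ E] [CompleteSpace E]
    (f : E → ℝ) (β μ : ℝ) (hμ : 0 < μ) (hμβ : μ ≤ β)
    (hdiff : Differentiable ℝ f)
    (hsmooth : ∀ v w : E, ‖gradient f v - gradient f w‖ ≤ β * ‖v - w‖)
    (hconv : ∀ v w : E,
      f v ≥ f w + inner (𝕜 := ℝ) (gradient f w) (v - w) + μ / 2 * ‖v - w‖ ^ 2) :
    ∀ v w : E,
      inner (𝕜 := ℝ) (gradient f v - gradient f w) (v - w)
        ≥ β * μ / (β + μ) * ‖v - w‖ ^ 2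
          + 1 / (β + μ) * ‖gradient f v - gradient f w‖ ^ 2 := by
  intro v w
  have hmodel (v w e : E) :
      f v + ⟪gradient f v, e - (v - w)⟫ + μ / 2 * ‖e - (v - w)‖ ^ 2
        ≤ f w + ⟪gradient f w, e⟫ + β / 2 * ‖e‖ ^ 2 := by
    have hlower := hconv (w + e) v
    rw [show w + e - v = e - (v - w) by abel] at hlower
    exact hlower.le.trans (le_quadratic_of_lipschitz_gradient hdiff hsmooth w e)
  have hsum (e : E) :
      2 * ⟪gradient f v - gradient f w - μ • (v - w), e⟫ - (β - μ) * ‖e‖ ^ 2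
        ≤ ⟪gradient f v - gradient f w, v - w⟫ - μ * ‖v - w‖ ^ 2 := by
    have h₁ := hmodel v w e
    have h₂ := hmodel w v (-e)
    rw [show -e - (w - v) = -(e - (v - w)) by abel, norm_neg, norm_neg] at h₂
    simp only [norm_sub_sq_real e (v - w), inner_neg_right, inner_sub_right (gradient f v) e,
      inner_sub_right (gradient f w) e] at h₁ h₂
    simp only [inner_sub_left (gradient f v - gradient f w), inner_sub_left (gradient f v),
      real_inner_smul_left, real_inner_comm e (v - w)] at *
    linarith
  set d := gradient f v - gradient f w
  set s := v - w
  have hkey : β * μ * ‖s‖ ^ 2 + ‖d‖ ^ 2 ≤ (β + μ) * ⟪d, s⟫ := by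
    rcases hμβ.eq_or_lt with rfl | hlt
    · have hinner : μ * ‖s‖ ^ 2 ≤ ⟪d, s⟫ := by simpa using hsum 0
      have hnorm : ‖d‖ ^ 2 ≤ (μ * ‖s‖) ^ 2 := by
        gcongr
        exact hsmooth v w
      nlinarith
    · have hgap : 0 < β - μ := sub_pos.2 hlt
      have hopt := hsum ((β - μ)⁻¹ • (d - μ • s))
      rw [real_inner_smul_right, real_inner_self_eq_norm_sq, norm_smul, mul_pow,
        Real.norm_of_nonneg (inv_nonneg.2 hgap.le)] at hopt
      have hp : ‖d - μ • s‖ ^ 2 = ‖d‖ ^ 2 - 2 * (μ * ⟪d, s⟫) + μ ^ 2 * ‖s‖ ^ 2 := by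
        rw [norm_sub_sq_real, real_inner_smul_right, norm_smul, mul_pow,
          Real.norm_of_nonneg hμ.le]
      have hbound : ‖d - μ • s‖ ^ 2 / (β - μ) ≤ ⟪d, s⟫ - μ * ‖s‖ ^ 2 := by
        convert hopt using 1
        field_simp
        ring
      rw [div_le_iff₀ hgap, hp] at hbound
      linarith
  have hpos : 0 < β + μ := by linarith
  rw [ge_iff_le, show β * μ / (β + μ) * ‖s‖ ^ 2 + 1 / (β + μ) * ‖d‖ ^ 2
    = (β * μ * ‖s‖ ^ 2 + ‖d‖ ^ 2) / (β + μ) by ring, div_le_iff₀' hpos]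
  exact hkey
end

section
/- Let E be a real inner product space and let f : E → ℝ be differentiable, β-smooth, and μ-strongly convex with 0 < μ ≤ β. Then for every step size η with 0 ≤ η ≤ 2/(β+μ) and all v, w ∈ E, the gradient-descent map G_{f,η}(v) = v − η∇f(v) satisfies ‖G_{f,η}(v) − G_{f,η}(w)‖² ≤ (1 − 2ηβμ/(β+μ))‖v − w‖² − η(2/(β+μ) − η)‖∇f(v) − ∇f(w)‖². -/
open scoped InnerProductSpace

/-- The descent lemma: a function with `β`-Lipschitz gradient lies below its quadratic
upper model. -/
lemma le_quadratic_of_gradient_lipschitz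
    {E : Type*} [NormedAddCommGroup E] [InnerProductSpace ℝ E] [CompleteSpace E]
    {f : E → ℝ} {β : ℝ} (hdiff : Differentiable ℝ f)
    (hsmooth : ∀ v w : E, ‖gradient f v - gradient f w‖ ≤ β * ‖v - w‖) (v w : E) :
    f v ≤ f w + ⟪gradient f w, v - w⟫_ℝ + β / 2 * ‖v - w‖ ^ 2 := by
  set d := v - w with hd
  have hderiv : ∀ t : ℝ, HasDerivAt
      (fun t : ℝ => f (w + t • d) - t * ⟪gradient f w, d⟫_ℝ - β / 2 * ‖d‖ ^ 2 * t ^ 2)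
      (⟪gradient f (w + t • d), d⟫_ℝ - ⟪gradient f w, d⟫_ℝ - β * ‖d‖ ^ 2 * t) t := by
    intro t
    have hline : HasDerivAt (fun t : ℝ => w + t • d) d t := by
      simpa using ((hasDerivAt_id t).smul_const d).const_add w
    have hf : HasDerivAt (fun t : ℝ => f (w + t • d)) ⟪gradient f (w + t • d), d⟫_ℝ t := by
      simpa [Function.comp_def] using
        (hdiff (w + t • d)).hasGradientAt.hasFDerivAt.comp_hasDerivAt t hline
    have hlin := (hasDerivAt_id t).mul_const ⟪gradient f w, d⟫_ℝ
    have hquad := (hasDerivAt_pow 2 t).const_mul (β / 2 * ‖d‖ ^ 2)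
    refine ((hf.sub hlin).sub hquad).congr_deriv ?_
    norm_num
    ring
  have hanti := antitoneOn_of_deriv_nonpos (convex_Icc (0 : ℝ) 1)
    (fun t _ => (hderiv t).continuousAt.continuousWithinAt)
    (fun t _ => (hderiv t).differentiableAt.differentiableWithinAt)
    (fun t ht => by
      rw [interior_Icc] at ht
      rw [(hderiv t).deriv, ← inner_sub_left]
      have hnorm := hsmooth (w + t • d) w
      rw [add_sub_cancel_left, norm_smul, Real.norm_of_nonneg ht.1.le] at hnorm
      have hcs := real_inner_le_norm (gradient f (w + t • d) - gradient f w) d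
      have := mul_le_mul_of_nonneg_right hnorm (norm_nonneg d)
      nlinarith)
  have h := hanti (Set.left_mem_Icc.2 zero_le_one) (Set.right_mem_Icc.2 zero_le_one) zero_le_one
  have hv : w + d = v := by rw [hd]; abel
  simp only [one_smul, zero_smul, hv, add_zero] at h
  linarith

/-- If `h` lies between its linear models with slopes `p` and the quadratic upper models of
curvature `L`, the gap to the linear model controls the variation of the slope. -/
lemma sq_norm_sub_le_linear_model_gap
    {E : Type*} [NormedAddCommGroup E] [InnerProductSpace ℝ E]
    {h : E → ℝ} {p : E → E} {L : ℝ} (hL : 0 < L)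
    (hlower : ∀ v w : E, h w + ⟪p w, v - w⟫_ℝ ≤ h v)
    (hupper : ∀ v w : E, h v ≤ h w + ⟪p w, v - w⟫_ℝ + L / 2 * ‖v - w‖ ^ 2) (v w : E) :
    ‖p v - p w‖ ^ 2 ≤ 2 * L * (h v - h w - ⟪p w, v - w⟫_ℝ) := by
  set g := p v - p w with hg
  have hlow := hlower (v - L⁻¹ • g) w
  have hup := hupper (v - L⁻¹ • g) v
  have hsplit : v - L⁻¹ • g - w = (v - w) - L⁻¹ • g := by abel
  rw [hsplit, inner_sub_right, inner_smul_right] at hlow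
  rw [sub_sub_cancel_left, inner_neg_right, inner_smul_right, norm_neg, norm_smul, mul_pow,
    Real.norm_of_nonneg (inv_nonneg.2 hL.le)] at hup
  have hgg : ⟪p v, g⟫_ℝ - ⟪p w, g⟫_ℝ = ‖g‖ ^ 2 := by
    rw [← inner_sub_left, real_inner_self_eq_norm_sq]
  have hgap : L⁻¹ * ‖g‖ ^ 2 - L / 2 * (L⁻¹ ^ 2 * ‖g‖ ^ 2) ≤ h v - h w - ⟪p w, v - w⟫_ℝ := by
    rw [← hgg] at hup ⊢
    linarith
  calc ‖g‖ ^ 2 = 2 * L * (L⁻¹ * ‖g‖ ^ 2 - L / 2 * (L⁻¹ ^ 2 * ‖g‖ ^ 2)) := by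
        field_simp
        ring
    _ ≤ _ := by gcongr

/-- Co-coercivity of the slopes `p` of a function lying between its linear models and its
quadratic upper models. -/
lemma sq_norm_sub_le_inner_of_quadratic_bounds
    {E : Type*} [NormedAddCommGroup E] [InnerProductSpace ℝ E]
    {h : E → ℝ} {p : E → E} {L : ℝ} (hL : 0 < L)
    (hlower : ∀ v w : E, h w + ⟪p w, v - w⟫_ℝ ≤ h v)
    (hupper : ∀ v w : E, h v ≤ h w + ⟪p w, v - w⟫_ℝ + L / 2 * ‖v - w‖ ^ 2) (v w : E) :
    ‖p v - p w‖ ^ 2 ≤ L * ⟪p v - p w, v - w⟫_ℝ := by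
  have hvw := sq_norm_sub_le_linear_model_gap hL hlower hupper v w
  have hwv := sq_norm_sub_le_linear_model_gap hL hlower hupper w v
  rw [norm_sub_rev, ← neg_sub v w, inner_neg_right] at hwv
  rw [inner_sub_left]
  linarith

/-- Sharpened co-coercivity of the gradient of a `β`-smooth, `μ`-strongly convex function. -/
lemma gradient_cocoercive_of_smooth_of_strongly_convex
    {E : Type*} [NormedAddCommGroup E] [InnerProductSpace ℝ E] [CompleteSpace E]
    {f : E → ℝ} {β μ : ℝ} (hμ : 0 < μ) (hμβ : μ ≤ β) (hdiff : Differentiable ℝ f)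
    (hsmooth : ∀ v w : E, ‖gradient f v - gradient f w‖ ≤ β * ‖v - w‖)
    (hconv : ∀ v w : E, f v ≥ f w + ⟪gradient f w, v - w⟫_ℝ + μ / 2 * ‖v - w‖ ^ 2)
    (v w : E) :
    β * μ * ‖v - w‖ ^ 2 + ‖gradient f v - gradient f w‖ ^ 2
      ≤ (β + μ) * ⟪gradient f v - gradient f w, v - w⟫_ℝ := by
  rcases hμβ.eq_or_lt with rfl | hlt
  · have hvw := hconv v w
    have hwv := hconv w v
    rw [norm_sub_rev, ← neg_sub v w, inner_neg_right] at hwv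
    have hmono : μ * ‖v - w‖ ^ 2 ≤ ⟪gradient f v - gradient f w, v - w⟫_ℝ := by
      rw [inner_sub_left]
      linarith
    have hsq := pow_le_pow_left₀ (norm_nonneg _) (hsmooth v w) 2
    nlinarith
  · have hexpand : ∀ x y : E, ‖x‖ ^ 2 = ‖y‖ ^ 2 + 2 * ⟪y, x - y⟫_ℝ + ‖x - y‖ ^ 2 := by
      intro x y
      rw [← norm_add_sq_real, add_sub_cancel]
    have hcoco := sq_norm_sub_le_inner_of_quadratic_bounds
      (h := fun x => f x - μ / 2 * ‖x‖ ^ 2) (p := fun x => gradient f x - μ • x)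
      (sub_pos.2 hlt)
      (fun x y => by
        have := hconv x y
        simp only [inner_sub_left, real_inner_smul_left]
        rw [hexpand x y]
        linarith)
      (fun x y => by
        have := le_quadratic_of_gradient_lipschitz hdiff hsmooth x y
        simp only [inner_sub_left (gradient f y), real_inner_smul_left]
        rw [hexpand x y]
        linarith) v w
    have hslope : gradient f v - μ • v - (gradient f w - μ • w)
        = (gradient f v - gradient f w) - μ • (v - w) := by
      rw [smul_sub]
      abel
    simp only [hslope] at hcoco
    rw [norm_sub_sq_real, inner_sub_left _ (μ • (v - w)), real_inner_smul_left,
      real_inner_smul_right, real_inner_self_eq_norm_sq, norm_smul, mul_pow,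
      Real.norm_of_nonneg hμ.le] at hcoco
    linarith

/-- Squared-norm contraction estimate for the gradient descent map of a `β`-smooth,
`μ`-strongly convex function with step size `η ≤ 2/(β+μ)`. -/
theorem gradient_descent_sq_contraction
    {E : Type*} [NormedAddCommGroup E] [InnerProductSpace ℝ E] [CompleteSpace E]
    (f : E → ℝ) (β μ : ℝ) (hμ : 0 < μ) (hμβ : μ ≤ β)
    (hdiff : Differentiable ℝ f)
    (hsmooth : ∀ v w : E, ‖gradient f v - gradient f w‖ ≤ β * ‖v - w‖)
    (hconv : ∀ v w : E,
      f v ≥ f w + inner (𝕜 := ℝ) (gradient f w) (v - w) + μ / 2 * ‖v - w‖ ^ 2) :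
    ∀ η : ℝ, 0 ≤ η → η ≤ 2 / (β + μ) → ∀ v w : E,
      ‖(v - η • gradient f v) - (w - η • gradient f w)‖ ^ 2
        ≤ (1 - 2 * η * β * μ / (β + μ)) * ‖v - w‖ ^ 2
          - η * (2 / (β + μ) - η) * ‖gradient f v - gradient f w‖ ^ 2 := by
  intro η hη _ v w
  have hcoco := gradient_cocoercive_of_smooth_of_strongly_convex hμ hμβ hdiff hsmooth hconv v w
  have hsum : 0 < β + μ := by linarith
  have hstep : (v - η • gradient f v) - (w - η • gradient f w)
      = (v - w) - η • (gradient f v - gradient f w) := by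
    rw [smul_sub]
    abel
  rw [hstep, norm_sub_sq_real, real_inner_smul_right, norm_smul, mul_pow,
    Real.norm_of_nonneg hη, real_inner_comm]
  have hdiv : (β * μ * ‖v - w‖ ^ 2 + ‖gradient f v - gradient f w‖ ^ 2) / (β + μ)
      ≤ ⟪gradient f v - gradient f w, v - w⟫_ℝ := by
    rwa [div_le_iff₀' hsum]
  have hscaled := mul_le_mul_of_nonneg_left hdiv (mul_nonneg zero_le_two hη)
  have hrhs : (1 - 2 * η * β * μ / (β + μ)) * ‖v - w‖ ^ 2
        - η * (2 / (β + μ) - η) * ‖gradient f v - gradient f w‖ ^ 2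
      = ‖v - w‖ ^ 2 - 2 * η * ((β * μ * ‖v - w‖ ^ 2
        + ‖gradient f v - gradient f w‖ ^ 2) / (β + μ))
        + η ^ 2 * ‖gradient f v - gradient f w‖ ^ 2 := by
    ring
  rw [hrhs]
  linarith
end

section
/- Let 0 < μ ≤ β, B ≥ 0, let T ≥ 1 be an integer, and let η_0, …, η_{T−1} be reals with 0 ≤ η_t ≤ 1/(βT) for all t. Let (a_t)_{t=0}^{T} be non-negative reals with a_0 = 0 and a_{t+1} ≤ e^{−η_t βμ/(β+μ)}(a_t + B η_t) for all 0 ≤ t < T. Then a_T ≤ (B/β) · e^{1 − μ/((β+μ)T)}. -/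
/-- If each step adds at most `c` after a non-expansive rescaling, then `n` steps starting
from `0` add at most `n * c`. -/
theorem le_nat_mul_of_nonexpansive_recursion {T : ℕ} {a r b : ℕ → ℝ} {c : ℝ}
    (ha : ∀ t, 0 ≤ a t) (ha0 : a 0 = 0) (hr : ∀ t < T, r t ≤ 1)
    (hb : ∀ t < T, 0 ≤ b t ∧ b t ≤ c)
    (hrec : ∀ t < T, a (t + 1) ≤ r t * (a t + b t)) :
    ∀ n ≤ T, a n ≤ n * c := by
  intro n
  induction n with
  | zero => simp [ha0]
  | succ n ih =>
    intro hn
    obtain ⟨hb0, hbc⟩ := hb n hn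
    have hstep := mul_le_of_le_one_left (add_nonneg (ha n) hb0) (hr n hn)
    have hprev := ih (Nat.le_of_succ_le hn)
    have hcurr := hrec n hn
    push_cast
    linarith

/-- Unrolling the strongly convex uniform-stability recursion:
if `a₀ = 0` and `a_{t+1} ≤ e^{−η_t βμ/(β+μ)}(a_t + Bη_t)` with `0 ≤ η_t ≤ 1/(βT)`,
then `a_T ≤ (B/β) e^{1 − μ/((β+μ)T)}`. -/
theorem stability_unrolling_strongly_convex
    (β μ B : ℝ) (hμ : 0 < μ) (hμβ : μ ≤ β) (hB : 0 ≤ B) (T : ℕ) (hT : 1 ≤ T)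
    (η : ℕ → ℝ) (hη : ∀ t < T, 0 ≤ η t ∧ η t ≤ 1 / (β * T))
    (a : ℕ → ℝ) (ha : ∀ t, 0 ≤ a t) (ha0 : a 0 = 0)
    (hrec : ∀ t < T,
      a (t + 1) ≤ Real.exp (-(η t * β * μ / (β + μ))) * (a t + B * η t)) :
    a T ≤ (B / β) * Real.exp (1 - μ / ((β + μ) * (T : ℝ))) := by
  have hβ : 0 < β := hμ.trans_le hμβ
  have hT1 : (1 : ℝ) ≤ T := by exact_mod_cast hT
  have hT0 : (0 : ℝ) < T := one_pos.trans_le hT1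
  have hlin : a T ≤ T * (B * (1 / (β * T))) := by
    refine le_nat_mul_of_nonexpansive_recursion ha ha0 (fun t ht => ?_) (fun t ht => ?_)
      hrec T le_rfl
    · have hη0 := (hη t ht).1
      exact Real.exp_le_one_iff.2 (neg_nonpos.2 (by positivity))
    · exact ⟨mul_nonneg hB (hη t ht).1, mul_le_mul_of_nonneg_left (hη t ht).2 hB⟩
  have hexp : 1 ≤ Real.exp (1 - μ / ((β + μ) * (T : ℝ))) := by
    rw [Real.one_le_exp_iff, sub_nonneg, div_le_one (by positivity)]
    nlinarith
  calc a T ≤ T * (B * (1 / (β * T))) := hlin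
    _ = B / β := by field_simp
    _ ≤ (B / β) * Real.exp (1 - μ / ((β + μ) * (T : ℝ))) :=
      le_mul_of_one_le_right (by positivity) hexp
end
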